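/- arXiv:2010.04405 — 10 statements merged into one kernel-verified Lean document; each statement's English description precedes it below -/
import Mathlib

section
/- Let n ≥ 1 be an integer and for m ∈ {0,…,n−1} set c(m) = (2m−n+1)π/(2n). Let x, y be real numbers such that for every m ∈ {0,…,n−1} one has cos(x/n − c(m)) ≠ 0 and cos(y/n − c(m))/cos(x/n − c(m)) > 0. Then ln(cos y / cos x) = Σ_{m=0}^{n−1} ln( cos(y/n − c(m)) / cos(x/n − c(m)) ); that is, the height function z(x,y) = ln(cos y / cos x) of Scherk's second minimal surface satisfies z(x,y) = Σ_{m=0}^{n−1} z(x/n − c(m), y/n − c(m)). -/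
open Real

theorem prod_range_one_sub_rootOfUnity_mul {R : Type*} [CommRing R] [IsDomain R]
    {n : ℕ} (hn : 0 < n) {ζ : R}
    (hζ : IsPrimitiveRoot ζ n) (b : R) :
    ∏ m ∈ Finset.range n, (1 - ζ ^ m * b) = 1 - b ^ n := by
  have h := congrArg (Polynomial.eval 1) (X_pow_sub_C_eq_prod hζ hn (rfl : b ^ n = b ^ n))
  simpa [Polynomial.eval_prod] using h.symm

theorem sum_range_two_mul_sub_add_one (n : ℕ) :
    ∑ m ∈ Finset.range n, (2 * (m : ℂ) - n + 1) = 0 := by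
  have h : ∀ k : ℕ, ∑ m ∈ Finset.range k, (2 * (m : ℂ) - n + 1) = k * (k - n) := by
    intro k
    induction k with
    | zero => simp
    | succ k ih => rw [Finset.sum_range_succ, ih]; push_cast; ring
  rw [h, sub_self, mul_zero]

/-- The multiple-angle product formula for the complex cosine. -/
theorem Complex.prod_two_mul_cos {n : ℕ} (hn : 0 < n) (x : ℂ) :
    ∏ m ∈ Finset.range n, (2 * Complex.cos (x / n - (2 * (m : ℂ) - n + 1) * π / (2 * n))) =
      2 * Complex.cos x := by
  have hn' : (n : ℂ) ≠ 0 := Nat.cast_ne_zero.mpr hn.ne'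
  set b : ℂ := Complex.exp (-2 * (x / n) * Complex.I + π * Complex.I / n) with hb
  have hfactor : ∀ m : ℕ, 2 * Complex.cos (x / n - (2 * (m : ℂ) - n + 1) * π / (2 * n)) =
      Complex.exp (x / n * Complex.I - (2 * (m : ℂ) - n + 1) * (π / (2 * n) * Complex.I)) *
        (1 - Complex.exp (2 * π * Complex.I / n) ^ m * b) := by
    intro m
    have hneg : Complex.exp (2 * π * Complex.I / n) ^ m * b = -Complex.exp
        (-2 * (x / n - (2 * (m : ℂ) - n + 1) * π / (2 * n)) * Complex.I) := by
      rw [hb, ← Complex.exp_nat_mul, ← Complex.exp_add, ← Complex.exp_add_pi_mul_I]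
      rw [Complex.exp_eq_exp_iff_exists_int]
      refine ⟨0, ?_⟩
      field_simp
      push_cast
      ring
    rw [Complex.two_cos, hneg, sub_neg_eq_add, mul_add, mul_one, ← Complex.exp_add]
    congr 2 <;> ring
  have hbn : b ^ n = -Complex.exp (-2 * x * Complex.I) := by
    rw [hb, ← Complex.exp_nat_mul, ← Complex.exp_add_pi_mul_I]
    congr 1
    field_simp
  rw [Finset.prod_congr rfl fun m _ => hfactor m, Finset.prod_mul_distrib,
    prod_range_one_sub_rootOfUnity_mul hn (Complex.isPrimitiveRoot_exp n hn.ne'),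
    ← Complex.exp_sum, Finset.sum_sub_distrib, ← Finset.sum_mul, ← Finset.sum_mul,
    sum_range_two_mul_sub_add_one, hbn, Complex.two_cos, sub_neg_eq_add, mul_add, mul_one,
    ← Complex.exp_add]
  simp only [Finset.sum_const, Finset.card_range, nsmul_eq_mul]
  congr 2 <;> field_simp <;> ring

/-- The multiple-angle product formula for the real cosine. -/
theorem Real.prod_two_mul_cos {n : ℕ} (hn : 0 < n) (x : ℝ) :
    ∏ m ∈ Finset.range n, (2 * Real.cos (x / n - (2 * (m : ℝ) - n + 1) * π / (2 * n))) =
      2 * Real.cos x := by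
  exact_mod_cast Complex.prod_two_mul_cos hn (x : ℂ)

/-- Finite decomposition of the height function `z(x,y) = ln(cos y / cos x)` of
Scherk's second minimal surface:
`z(x,y) = ∑_{m=0}^{n-1} z(x/n - c(m), y/n - c(m))` with `c(m) = (2m-n+1)π/(2n)`. -/
theorem scherk_second_surface_finite_decomposition
    (n : ℕ) (hn : 1 ≤ n) (c : ℕ → ℝ)
    (hc : ∀ m, c m = (2 * (m : ℝ) - (n : ℝ) + 1) * π / (2 * (n : ℝ)))
    (x y : ℝ)
    (hcos : ∀ m < n, Real.cos (x / n - c m) ≠ 0)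
    (hpos : ∀ m < n, 0 < Real.cos (y / n - c m) / Real.cos (x / n - c m)) :
    Real.log (Real.cos y / Real.cos x) =
      ∑ m ∈ Finset.range n,
        Real.log (Real.cos (y / n - c m) / Real.cos (x / n - c m)) := by
  rw [← Real.log_prod fun m hm => (hpos m (Finset.mem_range.mp hm)).ne']
  congr 1
  rw [← mul_div_mul_left (Real.cos y) (Real.cos x) two_ne_zero, ← Real.prod_two_mul_cos hn x,
    ← Real.prod_two_mul_cos hn y, ← Finset.prod_div_distrib]
  refine Finset.prod_congr rfl fun m _ => ?_
  rw [mul_div_mul_left _ _ two_ne_zero, hc]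
end

section
/- Let n ≥ 1 be an integer and for m ∈ {0,…,n−1} set c(m) = (2m−n+1)π/(2n). Then for all complex numbers x and y, cos x · Π_{m=0}^{n−1} cos(y/n − c(m)) = cos y · Π_{m=0}^{n−1} cos(x/n − c(m)). -/
/-- The product of the shifted cosines is a constant multiple of `cos z`. -/
theorem two_pow_mul_prod_cos_div_sub {n : ℕ} (hn : n ≠ 0) (z : ℂ) :
    2 ^ n * ∏ m ∈ Finset.range n,
        Complex.cos (z / n - (2 * (m : ℂ) - (n : ℂ) + 1) * (Real.pi : ℂ) / (2 * (n : ℂ))) =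
      2 * Complex.cos z := by
  have hn' : (n : ℂ) ≠ 0 := Nat.cast_ne_zero.mpr hn
  set c : ℕ → ℂ := fun m ↦ (2 * (m : ℂ) - (n : ℂ) + 1) * (Real.pi : ℂ) / (2 * (n : ℂ)) with hc
  set ζ : ℂ := Complex.exp (2 * Real.pi * Complex.I / n) with hζ
  set α : ℂ := Complex.exp (-2 * Complex.I * z / n + Real.pi * Complex.I / n) with hα
  have factor (m : ℕ) : 2 * Complex.cos (z / n - c m) =
      Complex.exp ((z / n - c m) * Complex.I) * (1 - ζ ^ m * α) := by
    have key : ζ ^ m * α = -Complex.exp (-2 * (z / n - c m) * Complex.I) := by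
      rw [hζ, hα, ← Complex.exp_nat_mul, ← Complex.exp_add, ← Complex.exp_add_pi_mul_I]
      congr 1
      simp only [hc]
      field_simp
      ring
    rw [key, sub_neg_eq_add, mul_add, mul_one, ← Complex.exp_add, Complex.two_cos]
    congr 2
    ring
  have sum_c (k : ℕ) : ∑ m ∈ Finset.range k, (z / n - c m) =
      k * (z / n) - (k * (k - n)) * Real.pi / (2 * n) := by
    induction k with
    | zero => simp
    | succ k ih =>
      rw [Finset.sum_range_succ, ih]
      simp only [hc]
      push_cast
      field_simp
      ring
  have α_pow : α ^ n = -Complex.exp (-2 * z * Complex.I) := by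
    rw [hα, ← Complex.exp_nat_mul, ← Complex.exp_add_pi_mul_I]
    congr 1
    field_simp
  have prod_roots : ∏ m ∈ Finset.range n, (1 - ζ ^ m * α) = 1 - α ^ n := by
    have h := congrArg (Polynomial.eval 1) (X_pow_sub_C_eq_prod
      (Complex.isPrimitiveRoot_exp n hn) (Nat.pos_of_ne_zero hn) (rfl : α ^ n = α ^ n))
    simpa [Polynomial.eval_prod] using h.symm
  calc 2 ^ n * ∏ m ∈ Finset.range n, Complex.cos (z / n - c m)
      = ∏ m ∈ Finset.range n, (2 * Complex.cos (z / n - c m)) := by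
        simp [Finset.prod_mul_distrib]
    _ = Complex.exp (z * Complex.I) * (1 + Complex.exp (-2 * z * Complex.I)) := by
        rw [Finset.prod_congr rfl fun m _ ↦ factor m, Finset.prod_mul_distrib, prod_roots,
          ← Complex.exp_sum, ← Finset.sum_mul, sum_c, α_pow, sub_neg_eq_add, sub_self, mul_zero,
          zero_mul, zero_div, sub_zero, mul_div_cancel₀ _ hn']
    _ = 2 * Complex.cos z := by
        rw [mul_add, mul_one, ← Complex.exp_add, Complex.two_cos]
        congr 2
        ring

/-- Exponentiated (branch-free) form of the finite decomposition of Scherk's second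
surface height function: for `c(m) = (2m-n+1)π/(2n)`,
`cos x · ∏_{m=0}^{n-1} cos(y/n - c(m)) = cos y · ∏_{m=0}^{n-1} cos(x/n - c(m))`
for all complex `x, y`. -/
theorem scherk_second_surface_product_identity
    (n : ℕ) (hn : 1 ≤ n) (c : ℕ → ℂ)
    (hc : ∀ m, c m = (2 * (m : ℂ) - (n : ℂ) + 1) * (Real.pi : ℂ) / (2 * (n : ℂ)))
    (x y : ℂ) :
    Complex.cos x * ∏ m ∈ Finset.range n, Complex.cos (y / n - c m) =
      Complex.cos y * ∏ m ∈ Finset.range n, Complex.cos (x / n - c m) := by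
  have hn' : n ≠ 0 := Nat.one_le_iff_ne_zero.mp hn
  have hx := two_pow_mul_prod_cos_div_sub hn' x
  have hy := two_pow_mul_prod_cos_div_sub hn' y
  simp only [← hc] at hx hy
  apply mul_left_cancel₀ (pow_ne_zero n (two_ne_zero (α := ℂ)))
  linear_combination Complex.cos x * hy - Complex.cos y * hx
end

section
/- Let n ≥ 1 be an integer, let y be a real number, and let x be a real number with 0 < x < π. Then arctan(tanh(y)·cot(x)) = Σ_{m=1}^{n−1} [ arctan( tanh(y/n)·cot((x+mπ)/n) ) − arctan( (y/n) / ((x+mπ)/n) ) ] + arctan( tanh(y/n)·cot(x/n) ) − Σ_{m=1}^{n−1} arctan( (y/n) / ((x+mπ)/n − π) ) + Σ_{m=1}^{n−1} arctan( y/(x+mπ) ) + Σ_{m=1}^{n−1} arctan( y/(x−mπ) ), where arctan denotes the principal inverse tangent with values in (−π/2, π/2). -/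
open Real

/-- The multiplication formula for the complex sine. -/
lemma Complex.sin_succ_mul_eq_two_pow_mul_prod (k : ℕ) (z : ℂ) :
    Complex.sin ((k + 1) * z) =
      2 ^ k * ∏ m ∈ Finset.range (k + 1), Complex.sin (z + m * π / (k + 1)) := by
  have hk : (k + 1 : ℂ) ≠ 0 := by exact_mod_cast k.succ_ne_zero
  set ζ : ℂ := Complex.exp (2 * π * Complex.I / (k + 1)) with hζ_def
  have hζ : IsPrimitiveRoot ζ (k + 1) := by
    simpa [hζ_def] using Complex.isPrimitiveRoot_exp (k + 1) k.succ_ne_zero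
  have hroots : ∏ m ∈ Finset.range (k + 1),
      (Complex.exp (-z * Complex.I) - ζ ^ m * Complex.exp (z * Complex.I)) =
      Complex.exp (-z * Complex.I) ^ (k + 1) - Complex.exp (z * Complex.I) ^ (k + 1) := by
    have h := congrArg (Polynomial.eval (Complex.exp (-z * Complex.I)))
      (X_pow_sub_C_eq_prod hζ k.succ_pos
        (rfl : Complex.exp (z * Complex.I) ^ (k + 1) = _))
    simpa [Polynomial.eval_prod] using h.symm
  have hphase : ∏ m ∈ Finset.range (k + 1), Complex.exp (-(m * π / (k + 1)) * Complex.I) =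
      (-Complex.I) ^ k := by
    have hsum : (∑ m ∈ Finset.range (k + 1), (m : ℂ)) * 2 = (k + 1) * k := by
      have h := Finset.sum_range_id_mul_two (k + 1)
      rw [Nat.add_sub_cancel] at h
      simpa using congrArg (Nat.cast : ℕ → ℂ) h
    have hI : Complex.exp (-π / 2 * Complex.I) = -Complex.I := by
      simp [Complex.exp_neg_pi_div_two_mul_I]
    rw [← Complex.exp_sum, ← hI, ← Complex.exp_nat_mul]
    congr 1
    calc ∑ m ∈ Finset.range (k + 1), -((m : ℂ) * π / (k + 1)) * Complex.I
        = (∑ m ∈ Finset.range (k + 1), (m : ℂ)) * (-π / (k + 1) * Complex.I) := by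
          rw [Finset.sum_mul]
          exact Finset.sum_congr rfl fun m _ ↦ by ring
      _ = k * (-π / 2 * Complex.I) := by
          field_simp
          linear_combination (-1 : ℂ) * hsum
  have hfactor (m : ℕ) : Complex.sin (z + m * π / (k + 1)) =
      Complex.I / 2 * (Complex.exp (-(m * π / (k + 1)) * Complex.I) *
        (Complex.exp (-z * Complex.I) - ζ ^ m * Complex.exp (z * Complex.I))) := by
    rw [Complex.sin, hζ_def, ← Complex.exp_nat_mul, mul_sub, ← Complex.exp_add,
      ← Complex.exp_add, ← Complex.exp_add]
    ring_nf
  simp_rw [hfactor]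
  rw [Finset.prod_mul_distrib, Finset.prod_mul_distrib, hroots, hphase, Finset.prod_const,
    Finset.card_range, ← Complex.exp_nat_mul, ← Complex.exp_nat_mul, Complex.sin]
  have hI : (2 : ℂ) ^ k * (Complex.I / 2) ^ k * (-Complex.I) ^ k = 1 := by
    rw [← mul_pow, ← mul_pow]
    simp [mul_div_cancel₀]
  have hneg : ((k + 1 : ℕ) : ℂ) * (-z * Complex.I) = -((k + 1) * z) * Complex.I := by
    push_cast
    ring
  have hpos : ((k + 1 : ℕ) : ℂ) * (z * Complex.I) = (k + 1) * z * Complex.I := by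
    push_cast
    ring
  rw [pow_succ, hneg, hpos]
  linear_combination (-Complex.I / 2) *
    (Complex.exp (-((k + 1) * z) * Complex.I) - Complex.exp ((k + 1) * z * Complex.I)) * hI

lemma Complex.arg_eq_arctan_of_re_pos {z : ℂ} (hz : 0 < z.re) :
    z.arg = Real.arctan (z.im / z.re) := by
  have h := abs_lt.1 (Complex.abs_arg_lt_pi_div_two_iff.2 (Or.inl hz))
  rw [← Complex.tan_arg, Real.arctan_tan h.1 h.2]

lemma Complex.re_sin_add_mul_I (x y : ℝ) :
    (Complex.sin (x + y * Complex.I)).re = Real.sin x * Real.cosh y := by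
  rw [Complex.sin_add_mul_I, ← Complex.ofReal_sin, ← Complex.ofReal_cos,
    ← Complex.ofReal_cosh, ← Complex.ofReal_sinh]
  simp [-Complex.ofReal_sin, -Complex.ofReal_cos, -Complex.ofReal_cosh, -Complex.ofReal_sinh]

/-- The height function of Scherk's first surface is the argument of the complex sine. -/
lemma Complex.arg_sin_add_mul_I {x : ℝ} (hx : 0 < Real.sin x) (y : ℝ) :
    (Complex.sin (x + y * Complex.I)).arg = Real.arctan (Real.tanh y * Real.cot x) := by
  have hy := Real.cosh_pos y
  have him : (Complex.sin (x + y * Complex.I)).im = Real.cos x * Real.sinh y := by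
    rw [Complex.sin_add_mul_I, ← Complex.ofReal_sin, ← Complex.ofReal_cos,
      ← Complex.ofReal_cosh, ← Complex.ofReal_sinh]
    simp [-Complex.ofReal_sin, -Complex.ofReal_cos, -Complex.ofReal_cosh, -Complex.ofReal_sinh]
  rw [Complex.arg_eq_arctan_of_re_pos (by rw [re_sin_add_mul_I]; positivity),
    re_sin_add_mul_I, him,
    Real.tanh_eq_sinh_div_cosh, Real.cot_eq_cos_div_sin]
  congr 1
  field_simp

lemma Complex.exp_arg_mul_I {z : ℂ} (hz : z ≠ 0) :
    Complex.exp (z.arg * Complex.I) = z / ‖z‖ := by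
  rw [eq_div_iff (by simpa using hz), mul_comm, Complex.norm_mul_exp_arg_mul_I]

/-- The height function of Scherk's first surface is a finite sum of scaled and translated
copies of itself. -/
lemma Real.arctan_tanh_mul_cot_eq_sum (k : ℕ) (y x : ℝ) (hx0 : 0 < x) (hxpi : x < π) :
    arctan (tanh y * cot x) =
      ∑ m ∈ Finset.range (k + 1),
        arctan (tanh (y / (k + 1)) * cot ((x + m * π) / (k + 1))) := by
  have hk : (0 : ℝ) < k + 1 := by positivity
  have hsin : ∀ m ∈ Finset.range (k + 1), 0 < sin ((x + m * π) / (k + 1)) := by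
    intro m hm
    have hmk : (m : ℝ) ≤ k := by exact_mod_cast Nat.lt_succ_iff.1 (Finset.mem_range.1 hm)
    refine sin_pos_of_pos_of_lt_pi (by positivity) ?_
    rw [div_lt_iff₀ hk]
    nlinarith [pi_pos]
  have hne {t : ℝ} (ht : 0 < sin t) (s : ℝ) : Complex.sin (t + s * Complex.I) ≠ 0 := by
    intro h
    have hre := Complex.re_sin_add_mul_I t s
    rw [h, Complex.zero_re] at hre
    exact (mul_pos ht (cosh_pos s)).ne hre
  have hcont : Continuous tanh := by
    simp_rw [funext tanh_eq_sinh_div_cosh]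
    exact continuous_sinh.div continuous_cosh fun s ↦ (cosh_pos s).ne'
  refine congrFun (Circle.isCoveringMap_exp.eq_of_comp_eq
    (g₁ := fun y ↦ arctan (tanh y * cot x))
    (g₂ := fun y ↦ ∑ m ∈ Finset.range (k + 1),
      arctan (tanh (y / (k + 1)) * cot ((x + m * π) / (k + 1))))
    (by fun_prop) (by fun_prop) (funext fun s ↦ Circle.ext ?_) 0 (by simp)) y
  have hx : 0 < sin x := sin_pos_of_pos_of_lt_pi hx0 hxpi
  have hprod : Complex.sin (x + s * Complex.I) =
      2 ^ k * ∏ m ∈ Finset.range (k + 1),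
        Complex.sin (((x + m * π) / (k + 1) : ℝ) + (s / (k + 1) : ℝ) * Complex.I) := by
    have hk' : (k + 1 : ℂ) ≠ 0 := by exact_mod_cast hk.ne'
    have h := Complex.sin_succ_mul_eq_two_pow_mul_prod k ((x + s * Complex.I) / (k + 1))
    rw [mul_div_cancel₀ _ hk'] at h
    rw [h]
    congr 1
    refine Finset.prod_congr rfl fun m _ ↦ congrArg Complex.sin ?_
    push_cast
    ring
  have hterm : ∀ m ∈ Finset.range (k + 1),
      Complex.exp (arctan (tanh (s / (k + 1)) * cot ((x + m * π) / (k + 1))) * Complex.I) =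
        Complex.sin (((x + m * π) / (k + 1) : ℝ) + (s / (k + 1) : ℝ) * Complex.I) /
        ‖Complex.sin (((x + m * π) / (k + 1) : ℝ) + (s / (k + 1) : ℝ) * Complex.I)‖ := by
    intro m hm
    rw [← Complex.arg_sin_add_mul_I (hsin m hm), Complex.exp_arg_mul_I (hne (hsin m hm) _)]
  simp only [Function.comp_apply, Circle.coe_exp]
  rw [← Complex.arg_sin_add_mul_I hx, Complex.exp_arg_mul_I (hne hx s), Complex.ofReal_sum,
    Finset.sum_mul, Complex.exp_sum, Finset.prod_congr rfl hterm, Finset.prod_div_distrib,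
    hprod, norm_mul, norm_prod]
  push_cast
  rw [norm_pow, Complex.norm_ofNat]
  push_cast
  exact mul_div_mul_left _ _ (pow_ne_zero k two_ne_zero)

/-- Finite decomposition of the height function `arctan(tanh(y)·cot(x))` of Scherk's
first minimal surface into scaled Scherk first surface height functions and
translated helicoid height functions. -/
theorem scherk_first_surface_helicoid_decomposition
    (n : ℕ) (hn : 1 ≤ n) (y x : ℝ) (hx0 : 0 < x) (hxpi : x < π) :
    Real.arctan (Real.tanh y * Real.cot x) =
      (∑ m ∈ Finset.Icc 1 (n - 1),
        (Real.arctan (Real.tanh (y / n) * Real.cot ((x + m * π) / n)) -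
          Real.arctan ((y / n) / ((x + m * π) / n))))
      + Real.arctan (Real.tanh (y / n) * Real.cot (x / n))
      - (∑ m ∈ Finset.Icc 1 (n - 1),
          Real.arctan ((y / n) / ((x + m * π) / n - π)))
      + (∑ m ∈ Finset.Icc 1 (n - 1), Real.arctan (y / (x + m * π)))
      + (∑ m ∈ Finset.Icc 1 (n - 1), Real.arctan (y / (x - m * π))) := by
  obtain ⟨k, rfl⟩ : ∃ k, n = k + 1 := ⟨n - 1, by omega⟩
  have hk : ((k + 1 : ℕ) : ℝ) ≠ 0 := by positivity
  have hIcc : Finset.Icc 1 (k + 1 - 1) = Finset.Ico 1 (k + 1) := by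
    ext m
    simp only [Finset.mem_Icc, Finset.mem_Ico]
    omega
  have hreflect : ∑ m ∈ Finset.Ico 1 (k + 1),
      arctan (y / (k + 1 : ℕ) / ((x + m * π) / (k + 1 : ℕ) - π)) =
      ∑ m ∈ Finset.Ico 1 (k + 1), arctan (y / (x - m * π)) := by
    refine Finset.sum_nbij' (fun m ↦ k + 1 - m) (fun m ↦ k + 1 - m) ?_ ?_ ?_ ?_ ?_
    · intro m hm; simp only [Finset.mem_Ico] at hm ⊢; omega
    · intro m hm; simp only [Finset.mem_Ico] at hm ⊢; omega
    · intro m hm; simp only [Finset.mem_Ico] at hm; omega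
    · intro m hm; simp only [Finset.mem_Ico] at hm; omega
    · intro m hm
      have hm' : m ≤ k + 1 := (Finset.mem_Ico.1 hm).2.le
      rw [div_sub' hk, div_div_div_cancel_right₀ hk, Nat.cast_sub hm']
      ring_nf
  have hmain := Real.arctan_tanh_mul_cot_eq_sum k y x hx0 hxpi
  rw [Finset.range_eq_Ico, Finset.sum_eq_sum_Ico_succ_bot k.succ_pos] at hmain
  rw [hIcc, hreflect, Finset.sum_sub_distrib, hmain]
  simp only [div_div_div_cancel_right₀ hk]
  push_cast
  simp only [zero_mul, add_zero]
  ring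
end

section
/- Let y be a real number and let x be a real number with 0 < x < π. Then the series Σ_{k=1}^{∞} [ arctan( y/(x+kπ) ) + arctan( y/(x−kπ) ) ] converges, and arctan( tanh(y)·cot(x) ) = arctan(y/x) + Σ_{k=1}^{∞} [ arctan( y/(x+kπ) ) + arctan( y/(x−kπ) ) ], where arctan denotes the principal inverse tangent with values in (−π/2, π/2). -/
open Real

lemma hasDerivAt_arctan_div {a : ℝ} (ha : a ≠ 0) (y : ℝ) :
    HasDerivAt (fun t : ℝ => arctan (t / a)) (a / (a ^ 2 + y ^ 2)) y := by
  convert! ((hasDerivAt_id y).div_const a).arctan using 1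
  have : 0 < a ^ 2 + y ^ 2 := by positivity
  simp only [id]
  field_simp

lemma abs_div_sq_add_sq_add_le {a b : ℝ} (ha : 0 < a) (hb : b < 0) (y : ℝ) :
    |a / (a ^ 2 + y ^ 2) + b / (b ^ 2 + y ^ 2)| ≤ |a + b| / -(a * b) := by
  have hab : 0 < -(a * b) := by nlinarith
  have ha2 : 0 < a ^ 2 + y ^ 2 := by positivity
  have hb2 : 0 < b ^ 2 + y ^ 2 := by nlinarith [sq_nonneg y]
  have key : a / (a ^ 2 + y ^ 2) + b / (b ^ 2 + y ^ 2)
      = (a + b) * ((a * b + y ^ 2) / ((a ^ 2 + y ^ 2) * (b ^ 2 + y ^ 2))) := by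
    field_simp
    ring
  rw [key, abs_mul, div_eq_mul_inv |a + b|]
  gcongr
  rw [abs_div, abs_of_pos (mul_pos ha2 hb2), inv_eq_one_div, div_le_div_iff₀ (by positivity) hab]
  have h1 : |a * b + y ^ 2| ≤ -(a * b) + y ^ 2 :=
    abs_le.mpr ⟨by nlinarith [sq_nonneg y], by linarith⟩
  nlinarith [mul_le_mul_of_nonneg_right h1 hab.le, sq_nonneg (y * (a + b)),
    sq_nonneg (y ^ 2), mul_nonneg hab.le (sq_nonneg y)]

lemma hasDerivAt_arctan_tanh_mul_cot {x : ℝ} (hx : sin x ≠ 0) (y : ℝ) :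
    HasDerivAt (fun t : ℝ => arctan (tanh t * cot x))
      (sin x * cos x / (sin x ^ 2 + sinh y ^ 2)) y := by
  have hc : cosh y ≠ 0 := (cosh_pos y).ne'
  have htanh : HasDerivAt tanh (1 / cosh y ^ 2) y := by
    have := (hasDerivAt_sinh y).div (hasDerivAt_cosh y) hc
    convert! this using 1
    · ext t
      exact tanh_eq_sinh_div_cosh t
    · rw [← cosh_sq_sub_sinh_sq y]
      ring
  convert! (htanh.mul_const (cot x)).arctan using 1
  rw [tanh_eq_sinh_div_cosh, cot_eq_cos_div_sin]
  have h1 : 0 < sin x ^ 2 + sinh y ^ 2 := by positivity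
  have h2 : sin x ^ 2 * cosh y ^ 2 + sinh y ^ 2 * cos x ^ 2 = sin x ^ 2 + sinh y ^ 2 := by
    rw [cosh_sq, cos_sq']
    ring
  have h3 : 1 + (sinh y / cosh y * (cos x / sin x)) ^ 2
      = (sin x ^ 2 + sinh y ^ 2) / (cosh y ^ 2 * sin x ^ 2) := by
    rw [← h2]
    field_simp
  rw [h3]
  field_simp

lemma re_cot_add_mul_I {x : ℝ} (hx : sin x ≠ 0) (y : ℝ) :
    (Complex.cot (x + y * Complex.I)).re = sin x * cos x / (sin x ^ 2 + sinh y ^ 2) := by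
  rw [Complex.cot_eq_cos_div_sin, Complex.sin_add_mul_I, Complex.cos_add_mul_I, Complex.div_re]
  have h1 : 0 < sin x ^ 2 + sinh y ^ 2 := by positivity
  have h2 : sin x ^ 2 * cosh y ^ 2 + cos x ^ 2 * sinh y ^ 2 = sin x ^ 2 + sinh y ^ 2 := by
    rw [cosh_sq, cos_sq']
    ring
  have hn : Complex.normSq (Complex.sin x * Complex.cosh y
      + Complex.cos x * Complex.sinh y * Complex.I) = sin x ^ 2 + sinh y ^ 2 := by
    rw [← h2, ← Complex.ofReal_sin, ← Complex.ofReal_cos, ← Complex.ofReal_sinh,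
      ← Complex.ofReal_cosh, ← Complex.ofReal_mul, ← Complex.ofReal_mul, Complex.normSq_add_mul_I]
    ring
  rw [hn, ← add_div]
  congr 1
  simp only [← Complex.ofReal_sin, ← Complex.ofReal_cos, ← Complex.ofReal_sinh,
    ← Complex.ofReal_cosh, Complex.add_re, Complex.add_im, Complex.sub_re, Complex.sub_im,
    Complex.mul_re, Complex.mul_im, Complex.ofReal_re, Complex.ofReal_im, Complex.I_re,
    Complex.I_im]
  linear_combination sin x * cos x * cosh_sq y

lemma re_one_div_add_mul_I (a y : ℝ) :
    (1 / ((a : ℂ) + y * Complex.I)).re = a / (a ^ 2 + y ^ 2) := by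
  rw [one_div, Complex.inv_re, Complex.normSq_add_mul_I]
  simp

/-- The real part of the Mittag-Leffler expansion of the cotangent. -/
lemma hasSum_re_cot {x : ℝ} (hx : sin x ≠ 0) (y : ℝ) :
    HasSum (fun k : ℕ => (x + ((k : ℝ) + 1) * π) / ((x + ((k : ℝ) + 1) * π) ^ 2 + y ^ 2) +
        (x - ((k : ℝ) + 1) * π) / ((x - ((k : ℝ) + 1) * π) ^ 2 + y ^ 2))
      (sin x * cos x / (sin x ^ 2 + sinh y ^ 2) - x / (x ^ 2 + y ^ 2)) := by
  have hpi : (π : ℂ) ≠ 0 := Complex.ofReal_ne_zero.mpr pi_ne_zero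
  set z : ℂ := x + y * Complex.I with hz
  have hmem : z / π ∈ Complex.integerComplement := by
    rintro ⟨n, hn⟩
    rw [eq_div_iff hpi] at hn
    have hre := congrArg Complex.re hn
    simp [hz] at hre
    exact hx (hre ▸ sin_int_mul_pi n)
  have hs := (summable_cotTerm hmem).hasSum
  have hval : ∑' n, cotTerm (z / π) n = _ := (cot_series_rep' hmem).symm
  rw [hval, mul_div_cancel₀ z hpi] at hs
  have hs' := Complex.hasSum_re (hs.div_const (π : ℂ))
  convert! hs' using 1
  · ext k
    have hterm : cotTerm (z / π) k / π
        = 1 / (((x + ((k : ℝ) + 1) * π : ℝ) : ℂ) + y * Complex.I)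
          + 1 / (((x - ((k : ℝ) + 1) * π : ℝ) : ℂ) + y * Complex.I) := by
      simp only [cotTerm]
      rw [add_div, div_div, div_div, sub_mul, add_mul (z / π), div_mul_cancel₀ z hpi, add_comm, hz]
      push_cast
      ring_nf
    rw [hterm, Complex.add_re, re_one_div_add_mul_I, re_one_div_add_mul_I]
  · have : (π * Complex.cot z - 1 / (z / π)) / π = Complex.cot z - 1 / z := by
      field_simp
    rw [this, Complex.sub_re, hz, re_cot_add_mul_I hx, re_one_div_add_mul_I]

/-- The Euler–Ramanujan arctangent identity
`arctan(tanh(y)·cot(x)) = arctan(y/x) + ∑_{k=1}^{∞} [arctan(y/(x+kπ)) + arctan(y/(x-kπ))]`,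
including the convergence of the series. -/
theorem euler_ramanujan_arctan_identity
    (y x : ℝ) (hx0 : 0 < x) (hxpi : x < π) :
    HasSum
      (fun k : ℕ =>
        Real.arctan (y / (x + ((k : ℝ) + 1) * π)) +
          Real.arctan (y / (x - ((k : ℝ) + 1) * π)))
      (Real.arctan (Real.tanh y * Real.cot x) - Real.arctan (y / x)) := by
  have hsin : sin x ≠ 0 := (sin_pos_of_pos_of_lt_pi hx0 hxpi).ne'
  have ha (k : ℕ) : 0 < x + ((k : ℝ) + 1) * π := by positivity
  have hb (k : ℕ) : x - ((k : ℝ) + 1) * π < 0 := by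
    nlinarith [mul_nonneg k.cast_nonneg pi_pos.le]
  have hd : 0 < π ^ 2 - x ^ 2 := by nlinarith
  let f (k : ℕ) (t : ℝ) : ℝ :=
    arctan (t / (x + ((k : ℝ) + 1) * π)) + arctan (t / (x - ((k : ℝ) + 1) * π))
  have hderiv (k : ℕ) (t : ℝ) :=
    (hasDerivAt_arctan_div (ha k).ne' t).add (hasDerivAt_arctan_div (hb k).ne t)
  let u (k : ℕ) : ℝ := 2 * x / (π ^ 2 - x ^ 2) * (1 / ((k + 1 : ℕ) : ℝ) ^ 2)
  have hu : Summable u :=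
    ((summable_nat_add_iff 1).mpr (summable_one_div_nat_pow.mpr one_lt_two)).mul_left _
  have hbound (k : ℕ) (t : ℝ) :
      ‖(x + ((k : ℝ) + 1) * π) / ((x + ((k : ℝ) + 1) * π) ^ 2 + t ^ 2) +
        (x - ((k : ℝ) + 1) * π) / ((x - ((k : ℝ) + 1) * π) ^ 2 + t ^ 2)‖ ≤ u k := by
    refine (abs_div_sq_add_sq_add_le (ha k) (hb k) t).trans ?_
    have hsum : x + ((k : ℝ) + 1) * π + (x - ((k : ℝ) + 1) * π) = 2 * x := by ring
    rw [hsum, abs_of_pos (by positivity)]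
    simp only [u]
    rw [div_mul_div_comm, mul_one]
    push_cast
    gcongr
    nlinarith [mul_nonneg (k.cast_nonneg (α := ℝ)) (sq_nonneg x),
      mul_nonneg (sq_nonneg (k : ℝ)) (sq_nonneg x)]
  have h0 : Summable fun k => f k 0 := by simp [f, summable_zero]
  have hsummable := summable_of_summable_hasDerivAt (g := f) hu hderiv hbound h0 y
  let G (t : ℝ) : ℝ := ∑' k, f k t - (arctan (tanh t * cot x) - arctan (t / x))
  have hG (t : ℝ) : HasDerivAt G 0 t := by
    have h1 := hasDerivAt_tsum (g := f) hu hderiv hbound h0 t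
    rw [(hasSum_re_cot hsin t).tsum_eq] at h1
    have h2 := h1.sub
      ((hasDerivAt_arctan_tanh_mul_cot hsin t).sub (hasDerivAt_arctan_div hx0.ne' t))
    rwa [sub_self] at h2
  have hconst : G y = G 0 :=
    is_const_of_deriv_eq_zero (fun t => (hG t).differentiableAt) (fun t => (hG t).deriv) y 0
  have hG0 : G 0 = 0 := by simp [G, f]
  have hval : ∑' k, f k y = arctan (tanh y * cot x) - arctan (y / x) :=
    sub_eq_zero.mp (hconst.trans hG0)
  exact hval ▸ hsummable.hasSum
end

section
/- Let A be a complex number that is not an odd multiple of π/2 (equivalently, cos A ≠ 0), and let X be any complex number. Then the partial products Π_{k=1}^{N} ( 1 − X/((k − 1/2)π − A) )·( 1 + X/((k − 1/2)π + A) ) converge, as N → ∞, to cos(X + A)/cos(A). -/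
/-- The partial products of Euler's sine product at `1 / 2 - z / π`, with the factors regrouped
around the zeros of the cosine. -/
lemma euler_sin_prod_shift (z : ℂ) (N : ℕ) :
    (Real.pi : ℂ) * (1 / 2 - z / Real.pi) *
        ∏ j ∈ Finset.range N, (1 - (1 / 2 - z / Real.pi) ^ 2 / ((j : ℂ) + 1) ^ 2) =
      (N + 1 / 2 - z / Real.pi) *
        (Real.pi * ∏ j ∈ Finset.range N, (1 / (Real.pi * ((j : ℂ) + 1)) ^ 2)) *
        ∏ k ∈ Finset.range N,
          (((((k : ℂ) + 1) - 1 / 2) * Real.pi - z) * ((((k : ℂ) + 1) - 1 / 2) * Real.pi + z)) := by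
  have hpi : (Real.pi : ℂ) ≠ 0 := by exact_mod_cast Real.pi_ne_zero
  induction N with
  | zero => simp; ring
  | succ n ih =>
    have hn : (n : ℂ) + 1 ≠ 0 := Nat.cast_add_one_ne_zero n
    rw [Finset.prod_range_succ, ← mul_assoc, ih, Finset.prod_range_succ, Finset.prod_range_succ]
    generalize ∏ j ∈ Finset.range n, (1 / ((Real.pi : ℂ) * ((j : ℂ) + 1)) ^ 2) = P
    generalize ∏ k ∈ Finset.range n, (((((k : ℂ) + 1) - 1 / 2) * (Real.pi : ℂ) - z) *
      ((((k : ℂ) + 1) - 1 / 2) * Real.pi + z)) = Q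
    push_cast
    field_simp
    ring

open Filter Topology in
lemma tendsto_natCast_add_one_div (c : ℂ) :
    Tendsto (fun N : ℕ => ((N : ℂ) + 1) / (N + c)) atTop (𝓝 1) := by
  simpa [add_comm] using
    tendsto_add_mul_div_add_mul_atTop_nhds (1 : ℂ) c 1 one_ne_zero

open Filter Topology in
/-- The cosine as a limit of polynomials, up to a normalisation that is independent of `z`. -/
lemma tendsto_cos_prod (z : ℂ) :
    Tendsto (fun N : ℕ =>
      ((N : ℂ) + 1) * (Real.pi * ∏ j ∈ Finset.range N, (1 / (Real.pi * ((j : ℂ) + 1)) ^ 2)) *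
        ∏ k ∈ Finset.range N,
          (((((k : ℂ) + 1) - 1 / 2) * Real.pi - z) * ((((k : ℂ) + 1) - 1 / 2) * Real.pi + z)))
      atTop (𝓝 (Complex.cos z)) := by
  have hpi : (Real.pi : ℂ) ≠ 0 := by exact_mod_cast Real.pi_ne_zero
  have hsin := Complex.tendsto_euler_sin_prod (1 / 2 - z / Real.pi)
  have hcos : Complex.sin (Real.pi * (1 / 2 - z / Real.pi)) = Complex.cos z := by
    rw [← Complex.sin_pi_div_two_sub]
    congr 1
    field_simp
  rw [hcos] at hsin
  have h := (tendsto_natCast_add_one_div (1 / 2 - z / Real.pi)).mul hsin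
  rw [one_mul] at h
  refine h.congr' ?_
  have hne : ∀ᶠ N : ℕ in atTop, (N : ℂ) + (1 / 2 - z / Real.pi) ≠ 0 := by
    filter_upwards [(tendsto_natCast_add_one_div (1 / 2 - z / Real.pi)).eventually_ne one_ne_zero]
      with N hN h0
    exact hN (by rw [h0, div_zero])
  filter_upwards [hne] with N hN
  rw [euler_sin_prod_shift, ← add_sub_assoc]
  rw [← add_sub_assoc] at hN
  rw [← mul_assoc, ← mul_assoc, div_mul_cancel₀ _ hN]

lemma half_odd_mul_pi_sub_ne_zero {A : ℂ} (hA : Complex.cos A ≠ 0) (k : ℕ) :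
    (((k : ℂ) + 1) - 1 / 2) * Real.pi - A ≠ 0 := by
  intro h
  refine hA (Complex.cos_eq_zero_iff.2 ⟨k, ?_⟩)
  push_cast
  linear_combination -h

/-- Ramanujan's infinite product identity: for complex `A` with `cos A ≠ 0` and any
complex `X`, the partial products
`∏_{k=1}^{N} (1 - X/((k-1/2)π - A))·(1 + X/((k-1/2)π + A))`
converge to `cos(X+A)/cos(A)` as `N → ∞`. -/
theorem ramanujan_cos_product_identity
    (A : ℂ) (hA : Complex.cos A ≠ 0) (X : ℂ) :
    Filter.Tendsto
      (fun N : ℕ => ∏ k ∈ Finset.range N,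
        ((1 - X / ((((k : ℂ) + 1) - 1 / 2) * (Real.pi : ℂ) - A)) *
          (1 + X / ((((k : ℂ) + 1) - 1 / 2) * (Real.pi : ℂ) + A))))
      Filter.atTop (nhds (Complex.cos (X + A) / Complex.cos A)) := by
  have hlim := (tendsto_cos_prod (X + A)).div (tendsto_cos_prod A) hA
  refine hlim.congr fun N => ?_
  have hpi : (Real.pi : ℂ) ≠ 0 := by exact_mod_cast Real.pi_ne_zero
  have hnorm : ((N : ℂ) + 1) *
      (Real.pi * ∏ j ∈ Finset.range N, (1 / (Real.pi * ((j : ℂ) + 1)) ^ 2)) ≠ 0 :=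
    mul_ne_zero (Nat.cast_add_one_ne_zero N) <| mul_ne_zero hpi <| Finset.prod_ne_zero_iff.2
      fun j _ => one_div_ne_zero (pow_ne_zero 2 (mul_ne_zero hpi (Nat.cast_add_one_ne_zero j)))
  rw [Pi.div_apply, mul_div_mul_left _ _ hnorm, ← Finset.prod_div_distrib]
  refine Finset.prod_congr rfl fun k _ => ?_
  have hsub := half_odd_mul_pi_sub_ne_zero hA k
  have hadd : (((k : ℂ) + 1) - 1 / 2) * Real.pi + A ≠ 0 := by
    have h := half_odd_mul_pi_sub_ne_zero (A := -A) (by rwa [Complex.cos_neg]) k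
    rwa [sub_neg_eq_add] at h
  rw [one_sub_div hsub, one_add_div hadd, div_mul_div_comm]
  ring
end

section
/- Let n ≥ 1 be an integer and for m ∈ {0,…,n−1} set c(m) = (2m−n+1)π/(2n). Then for all complex numbers x and y, cosh x · Π_{m=0}^{n−1} cosh( y/n + i·c(m) ) = cosh y · Π_{m=0}^{n−1} cosh( x/n + i·c(m) ). -/
/-- Up to a constant independent of `x`, the shifted values of `cosh` at `x / n` multiply to
`cosh x`. -/
lemma prod_cosh_div_add_shift (n : ℕ) (hn : 1 ≤ n) (c : ℕ → ℝ)
    (hc : ∀ m, c m = (2 * (m : ℝ) - (n : ℝ) + 1) * Real.pi / (2 * (n : ℝ))) (x : ℂ) :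
    ∏ m ∈ Finset.range n, Complex.cosh (x / n + Complex.I * (c m : ℂ)) =
      (∏ m ∈ Finset.range n, Complex.exp (-(Complex.I * (c m : ℂ))) / 2) *
        (2 * Complex.cosh x) := by
  have hn' : (n : ℂ) ≠ 0 := by exact_mod_cast (by omega : n ≠ 0)
  set ζ := Complex.exp (2 * Real.pi * Complex.I / n) with hζ
  set α := Complex.exp (Real.pi * Complex.I / n) with hα
  have hαn : α ^ n = -1 := by
    rw [hα, ← Complex.exp_nat_mul, mul_div_cancel₀ _ hn', Complex.exp_pi_mul_I]
  have hroots := congrArg (Polynomial.eval (Complex.exp (-2 * (x / n))))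
    (X_pow_sub_C_eq_prod (Complex.isPrimitiveRoot_exp n (by omega)) hn hαn)
  simp only [Polynomial.eval_sub, Polynomial.eval_pow, Polynomial.eval_X, Polynomial.eval_C,
    Polynomial.eval_prod, ← hζ] at hroots
  have hroot (m : ℕ) : ζ ^ m * α = -Complex.exp (2 * (Complex.I * (c m : ℂ))) := by
    rw [hζ, hα, ← Complex.exp_nat_mul, ← Complex.exp_add, ← Complex.exp_add_pi_mul_I, hc]
    congr 1
    push_cast
    field_simp
    ring
  have hfactor (m : ℕ) : Complex.cosh (x / n + Complex.I * (c m : ℂ)) =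
      Complex.exp (-(Complex.I * (c m : ℂ))) / 2 *
        (Complex.exp (x / n) * (Complex.exp (-2 * (x / n)) - ζ ^ m * α)) := by
    rw [hroot, sub_neg_eq_add, mul_add, ← Complex.exp_add, ← Complex.exp_add, div_mul_eq_mul_div,
      mul_add, ← Complex.exp_add, ← Complex.exp_add, Complex.cosh, add_comm]
    congr 3 <;> ring
  rw [Finset.prod_congr rfl fun m _ => hfactor m, Finset.prod_mul_distrib,
    Finset.prod_mul_distrib, ← hroots, Finset.prod_const, Finset.card_range,
    ← Complex.exp_nat_mul, ← Complex.exp_nat_mul, mul_div_cancel₀ _ hn', mul_left_comm _ (-2),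
    mul_div_cancel₀ _ hn', Complex.two_cosh, sub_neg_eq_add, mul_add, ← Complex.exp_add, mul_one,
    add_comm (Complex.exp _)]
  congr 4
  ring

/-- Exponentiated (branch-free) form of the finite decomposition of the complex
Scherk second maximal surface height function `z(x,y) = log(cosh y / cosh x)`:
for `c(m) = (2m-n+1)π/(2n)`,
`cosh x · ∏_{m=0}^{n-1} cosh(y/n + i·c(m)) = cosh y · ∏_{m=0}^{n-1} cosh(x/n + i·c(m))`. -/
theorem scherk_maximal_surface_product_identity
    (n : ℕ) (hn : 1 ≤ n) (c : ℕ → ℝ)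
    (hc : ∀ m, c m = (2 * (m : ℝ) - (n : ℝ) + 1) * Real.pi / (2 * (n : ℝ)))
    (x y : ℂ) :
    Complex.cosh x *
        ∏ m ∈ Finset.range n, Complex.cosh (y / n + Complex.I * (c m : ℂ)) =
      Complex.cosh y *
        ∏ m ∈ Finset.range n, Complex.cosh (x / n + Complex.I * (c m : ℂ)) := by
  rw [prod_cosh_div_add_shift n hn c hc x, prod_cosh_div_add_shift n hn c hc y]
  ring
end

section
/- Let n ≥ 1 be an integer and for m ∈ {0,…,n−1} set c(m) = (2m−n+1)π/(2n). Then for all complex numbers x and y, cos x · Π_{m=0}^{n−1} cosh( y/n + i·c(m) ) = cosh y · Π_{m=0}^{n−1} cos( x/n − c(m) ). -/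
open Complex in
/-- The product formula `2 ^ n * ∏ cos (t - c m) = 2 * cos (n * t)` at the nodes
`c m = (2 * m - n + 1) * π / (2 * n)`, which are symmetric about `0`. -/
theorem Complex.two_pow_mul_prod_cos_sub {n : ℕ} (hn : 0 < n) (t : ℂ) :
    2 ^ n * ∏ m ∈ Finset.range n, cos (t - (2 * m - n + 1) * Real.pi / (2 * n)) =
      2 * cos (n * t) := by
  have hn0 : (n : ℂ) ≠ 0 := Nat.cast_ne_zero.mpr hn.ne'
  let ζ : ℂ := (exp (2 * Real.pi * I / n))⁻¹
  have hζ : IsPrimitiveRoot ζ n := (isPrimitiveRoot_exp n hn.ne').inv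
  let b : ℂ := exp (t * I - Real.pi / n * I)
  have hb : b ^ n = - exp (n * t * I) := by
    rw [← exp_nat_mul, show (n : ℂ) * (t * I - Real.pi / n * I) =
      n * t * I - Real.pi * I by field_simp, exp_sub, exp_pi_mul_I, div_neg, div_one]
  have hprod : exp (-t * I) ^ n - b ^ n =
      ∏ m ∈ Finset.range n, (exp (-t * I) - ζ ^ m * b) := by
    simpa [Polynomial.eval_prod] using
      congrArg (Polynomial.eval (exp (-t * I))) (X_pow_sub_C_eq_prod hζ hn (rfl : b ^ n = b ^ n))
  have hterm (m : ℕ) : 2 * cos (t - (2 * m - n + 1) * Real.pi / (2 * n)) =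
      exp ((2 * m - n + 1) * Real.pi / (2 * n) * I) * (exp (-t * I) - ζ ^ m * b) := by
    have hneg : -(ζ ^ m * b) = exp (t * I - (2 * m - n + 1) * Real.pi / n * I) := by
      dsimp only [ζ, b]
      rw [← exp_neg, ← exp_nat_mul, ← exp_add, ← neg_one_mul, ← exp_pi_mul_I, ← exp_add]
      congr 1
      field_simp
      ring
    rw [two_cos, sub_eq_add_neg (exp _), hneg, mul_add, ← exp_add, ← exp_add, add_comm]
    congr 2 <;> field_simp <;> ring
  have hsum : ∑ m ∈ Finset.range n, (2 * m - n + 1 : ℂ) = 0 := by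
    have h : ∀ k : ℕ, ∑ m ∈ Finset.range k, (2 * m - n + 1 : ℂ) = k * (k - n) := by
      intro k
      induction k with
      | zero => simp
      | succ k ih => rw [Finset.sum_range_succ, ih]; push_cast; ring
    simp [h]
  calc
    _ = ∏ m ∈ Finset.range n, (2 * cos (t - (2 * m - n + 1) * Real.pi / (2 * n))) := by
      simp [Finset.prod_mul_distrib]
    _ = exp (-t * I) ^ n - b ^ n := by
      simp_rw [hterm]
      rw [Finset.prod_mul_distrib, ← hprod, ← exp_sum, ← Finset.sum_mul, ← Finset.sum_div,
        ← Finset.sum_mul, hsum]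
      simp
    _ = _ := by
      rw [hb, ← exp_nat_mul, two_cos, sub_neg_eq_add, add_comm]
      congr 2
      ring

/-- Exponentiated (branch-free) form of the finite decomposition of the complex
Born–Infeld soliton height function `z(x,y) = log(cosh y / cos x)`:
for `c(m) = (2m-n+1)π/(2n)`,
`cos x · ∏_{m=0}^{n-1} cosh(y/n + i·c(m)) = cosh y · ∏_{m=0}^{n-1} cos(x/n - c(m))`. -/
theorem born_infeld_soliton_product_identity
    (n : ℕ) (hn : 1 ≤ n) (c : ℕ → ℝ)
    (hc : ∀ m, c m = (2 * (m : ℝ) - (n : ℝ) + 1) * Real.pi / (2 * (n : ℝ)))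
    (x y : ℂ) :
    Complex.cos x *
        ∏ m ∈ Finset.range n, Complex.cosh (y / n + Complex.I * (c m : ℂ)) =
      Complex.cosh y *
        ∏ m ∈ Finset.range n, Complex.cos (x / n - (c m : ℂ)) := by
  have hn0 : (n : ℂ) ≠ 0 := Nat.cast_ne_zero.mpr (by omega)
  have hcos (z : ℂ) :
      2 ^ n * ∏ m ∈ Finset.range n, Complex.cos (z / n - (c m : ℂ)) = 2 * Complex.cos z := by
    simpa [hc, mul_div_cancel₀ z hn0] using Complex.two_pow_mul_prod_cos_sub hn (z / n)
  have hcosh : ∏ m ∈ Finset.range n, Complex.cosh (y / n + Complex.I * (c m : ℂ)) =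
      ∏ m ∈ Finset.range n, Complex.cos (y * Complex.I / n - (c m : ℂ)) := by
    refine Finset.prod_congr rfl fun m _ => ?_
    rw [← Complex.cos_mul_I]
    congr 1
    linear_combination (c m : ℂ) * Complex.I_mul_I
  have hy := hcos (y * Complex.I)
  rw [Complex.cos_mul_I, ← hcosh] at hy
  refine mul_left_cancel₀ (pow_ne_zero n (two_ne_zero (α := ℂ))) ?_
  linear_combination Complex.cos x * hy - Complex.cosh y * hcos x
end

section
/- The function Z(x,y) = ln( cosh x / cosh y ) satisfies the maximal surface equation (1 − Z_x²) Z_yy + 2 Z_x Z_y Z_xy + (1 − Z_y²) Z_xx = 0 at every point (x,y) of ℝ². -/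
/-- Partial derivative in the first variable. -/
noncomputable def pdx (Z : ℝ × ℝ → ℝ) (p : ℝ × ℝ) : ℝ :=
  deriv (fun t => Z (t, p.2)) p.1

/-- Partial derivative in the second variable. -/
noncomputable def pdy (Z : ℝ × ℝ → ℝ) (p : ℝ × ℝ) : ℝ :=
  deriv (fun t => Z (p.1, t)) p.2

/-- The maximal surface equation
`(1 - Z_x²) Z_yy + 2 Z_x Z_y Z_xy + (1 - Z_y²) Z_xx = 0` at a point `p`. -/
def MaximalEq (Z : ℝ × ℝ → ℝ) (p : ℝ × ℝ) : Prop :=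
  (1 - (pdx Z p) ^ 2) * pdy (pdy Z) p +
      2 * pdx Z p * pdy Z p * pdy (pdx Z) p +
    (1 - (pdy Z p) ^ 2) * pdx (pdx Z) p = 0

theorem hasDerivAt_log_cosh (x : ℝ) :
    HasDerivAt (fun t => Real.log (Real.cosh t)) (Real.tanh x) x := by
  rw [Real.tanh_eq_sinh_div_cosh]
  exact (Real.hasDerivAt_cosh x).log (Real.cosh_pos x).ne'

theorem deriv_tanh (x : ℝ) : deriv Real.tanh x = 1 - Real.tanh x ^ 2 := by
  have hx := (Real.cosh_pos x).ne'
  have h := (Real.hasDerivAt_sinh x).div (Real.hasDerivAt_cosh x) hx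
  have e : Real.tanh = Real.sinh / Real.cosh := funext Real.tanh_eq_sinh_div_cosh
  rw [e, h.deriv, Pi.div_apply]
  field_simp

theorem log_cosh_div_cosh (x y : ℝ) :
    Real.log (Real.cosh x / Real.cosh y) = Real.log (Real.cosh x) - Real.log (Real.cosh y) :=
  Real.log_div (Real.cosh_pos x).ne' (Real.cosh_pos y).ne'

theorem pdx_log_cosh_div_cosh :
    pdx (fun q => Real.log (Real.cosh q.1 / Real.cosh q.2)) = fun q => Real.tanh q.1 := by
  funext p
  simp only [pdx, log_cosh_div_cosh]
  exact ((hasDerivAt_log_cosh p.1).sub_const _).deriv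

theorem pdy_log_cosh_div_cosh :
    pdy (fun q => Real.log (Real.cosh q.1 / Real.cosh q.2)) = fun q => -Real.tanh q.2 := by
  funext p
  simp only [pdy, log_cosh_div_cosh]
  exact ((hasDerivAt_log_cosh p.2).const_sub _).deriv

/-- Scherk's maximal surface of the second kind: `Z(x,y) = ln(cosh x / cosh y)`
satisfies the maximal surface equation at every point of `ℝ²`. -/
theorem scherk_second_maximal_surface_is_maximal :
    ∀ p : ℝ × ℝ,
      MaximalEq (fun q => Real.log (Real.cosh q.1 / Real.cosh q.2)) p := by
  intro p
  have hxx : pdx (fun q => Real.tanh q.1) p = 1 - Real.tanh p.1 ^ 2 := deriv_tanh p.1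
  have hxy : pdy (fun q => Real.tanh q.1) p = 0 := deriv_const p.2 (Real.tanh p.1)
  have hyy : pdy (fun q => -Real.tanh q.2) p = -(1 - Real.tanh p.2 ^ 2) := by
    rw [← deriv_tanh]
    exact deriv.fun_neg
  rw [MaximalEq, pdx_log_cosh_div_cosh, pdy_log_cosh_div_cosh, hxx, hxy, hyy]
  ring
end

section
/- Let U ⊆ ℂ × ℂ be open and let Z : ℂ × ℂ → ℂ be a function that is twice complex-differentiable on U (i.e., analytic on U in the two complex variables) and satisfies the complex minimal surface equation (1 + Z_x²) Z_yy − 2 Z_x Z_y Z_xy + (1 + Z_y²) Z_xx = 0 at every point of U, where subscripts denote complex partial derivatives. Then the function W(x,y) := Z(x, i·y) satisfies the complex Born–Infeld soliton equation (1 − W_y²) W_xx + 2 W_x W_y W_xy − (1 + W_x²) W_yy = 0 at every point (x,y) such that (x, i·y) ∈ U. -/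
/-- Complex partial derivative in the first variable. -/
noncomputable def cpdx (Z : ℂ × ℂ → ℂ) (p : ℂ × ℂ) : ℂ :=
  deriv (fun t => Z (t, p.2)) p.1

/-- Complex partial derivative in the second variable. -/
noncomputable def cpdy (Z : ℂ × ℂ → ℂ) (p : ℂ × ℂ) : ℂ :=
  deriv (fun t => Z (p.1, t)) p.2

/-- The complex minimal surface equation
`(1 + Z_x²) Z_yy - 2 Z_x Z_y Z_xy + (1 + Z_y²) Z_xx = 0` at a point `p`. -/
def CMinimalEq (Z : ℂ × ℂ → ℂ) (p : ℂ × ℂ) : Prop :=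
  (1 + (cpdx Z p) ^ 2) * cpdy (cpdy Z) p -
      2 * cpdx Z p * cpdy Z p * cpdy (cpdx Z) p +
    (1 + (cpdy Z p) ^ 2) * cpdx (cpdx Z) p = 0

/-- The complex Born–Infeld soliton equation
`(1 - Z_y²) Z_xx + 2 Z_x Z_y Z_xy - (1 + Z_x²) Z_yy = 0` at a point `p`. -/
def CBornInfeldEq (Z : ℂ × ℂ → ℂ) (p : ℂ × ℂ) : Prop :=
  (1 - (cpdy Z p) ^ 2) * cpdx (cpdx Z) p +
      2 * cpdx Z p * cpdy Z p * cpdy (cpdx Z) p -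
    (1 + (cpdx Z p) ^ 2) * cpdy (cpdy Z) p = 0

/-- Precomposing with a dilation of the second variable commutes with the first partial derivative. -/
theorem cpdx_comp_mul_snd (Z : ℂ × ℂ → ℂ) (c : ℂ) :
    cpdx (fun q => Z (q.1, c * q.2)) = fun q => cpdx Z (q.1, c * q.2) :=
  rfl

/-- Precomposing with a dilation of the second variable scales the second partial derivative. -/
theorem cpdy_comp_mul_snd (Z : ℂ × ℂ → ℂ) (c : ℂ) :
    cpdy (fun q => Z (q.1, c * q.2)) = fun q => c * cpdy Z (q.1, c * q.2) := by
  funext q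
  simpa [cpdy] using deriv_comp_mul_left c (fun t => Z (q.1, t)) q.2

theorem cpdy_const_mul (Z : ℂ × ℂ → ℂ) (c : ℂ) :
    cpdy (fun q => c * Z q) = fun q => c * cpdy Z q := by
  funext q
  simp [cpdy]

/-- The Wick rotation `y → i·y` turns a complex minimal surface into a complex
Born–Infeld soliton. -/
theorem complex_minimal_to_born_infeld_wick_rotation
    (U : Set (ℂ × ℂ)) (hU : IsOpen U) (Z : ℂ × ℂ → ℂ)
    (hZ : ContDiffOn ℂ 2 Z U)
    (hmin : ∀ p ∈ U, CMinimalEq Z p)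
    (W : ℂ × ℂ → ℂ)
    (hW : ∀ q : ℂ × ℂ, W q = Z (q.1, Complex.I * q.2)) :
    ∀ p : ℂ × ℂ, (p.1, Complex.I * p.2) ∈ U → CBornInfeldEq W p := by
  intro p hp
  obtain rfl : W = fun q => Z (q.1, Complex.I * q.2) := funext hW
  have h := hmin _ hp
  unfold CMinimalEq at h
  unfold CBornInfeldEq
  simp only [cpdx_comp_mul_snd, cpdy_comp_mul_snd, cpdy_const_mul]
  linear_combination h + (-cpdy Z (p.1, Complex.I * p.2) ^ 2 *
      cpdx (cpdx Z) (p.1, Complex.I * p.2) +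
    2 * cpdx Z (p.1, Complex.I * p.2) * cpdy Z (p.1, Complex.I * p.2) *
      cpdy (cpdx Z) (p.1, Complex.I * p.2) -
    (1 + cpdx Z (p.1, Complex.I * p.2) ^ 2) * cpdy (cpdy Z) (p.1, Complex.I * p.2)) *
      Complex.I_sq
end

section
/- For real numbers x, y and a real parameter α define h(x, y; α) := −sec(α/2) · arctan( tanh( (x/2)·sin α ) / tan( y·sin(α/2) ) ), where arctan is the principal inverse tangent. Let n ≥ 1 be an integer and let β, β̃ be real numbers with cos β ≠ 0, cos β̃ ≠ 0, sin β̃ ≠ 0, and sin β = n·sin β̃. Let x be any real number and let y be a real number such that y·sin β̃ + mπ/n is not an integer multiple of π for any m ∈ {0,…,n−1}. Then h( x·sec β, y; 2β ) = (cos β̃ / cos β) · Σ_{m=0}^{n−1} h( x·sec β̃, y + (m/n)·π·csc β̃; 2β̃ ). -/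
open Real

/-- Kamien's height function for the one-parameter family of Scherk first surfaces:
`h(x, y; α) = -sec(α/2) · arctan( tanh((x/2)·sin α) / tan(y·sin(α/2)) )`. -/
noncomputable def kamienH (x y α : ℝ) : ℝ :=
  -(1 / Real.cos (α / 2)) *
    Real.arctan (Real.tanh ((x / 2) * Real.sin α) / Real.tan (y * Real.sin (α / 2)))

/-- Partial fractions of `n / (1 - wⁿ)` over the `n`-th roots of unity. -/
lemma IsPrimitiveRoot.sum_inv_one_sub_mul_pow {K : Type*} [Field K] {n : ℕ} {ζ w : K}
    (hζ : IsPrimitiveRoot ζ n) (hw : w ^ n ≠ 1) :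
    ∑ m ∈ Finset.range n, (1 - w * ζ ^ m)⁻¹ = n * (1 - w ^ n)⁻¹ := by
  have hn : 0 < n := Nat.pos_of_ne_zero fun h => hw (by simp [h])
  have hw' : 1 - w ^ n ≠ 0 := sub_ne_zero.mpr hw.symm
  have expand (m : ℕ) : (1 - w * ζ ^ m)⁻¹ =
      (∑ k ∈ Finset.range n, w ^ k * (ζ ^ k) ^ m) * (1 - w ^ n)⁻¹ := by
    have hpow : (w * ζ ^ m) ^ n = w ^ n := by
      rw [mul_pow, ← pow_mul, mul_comm m, pow_mul, hζ.pow_eq_one, one_pow, mul_one]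
    have hne : 1 - w * ζ ^ m ≠ 0 := fun h => hw (by
      rw [← hpow, ← sub_eq_zero.mp h, one_pow])
    have hgeom := mul_neg_geom_sum (w * ζ ^ m) n
    rw [hpow] at hgeom
    have hsum : ∑ k ∈ Finset.range n, w ^ k * (ζ ^ k) ^ m =
        ∑ k ∈ Finset.range n, (w * ζ ^ m) ^ k :=
      Finset.sum_congr rfl fun k _ => by rw [mul_pow, ← pow_mul, ← pow_mul, mul_comm k]
    rw [hsum]
    field_simp
    exact hgeom.symm
  rw [Finset.sum_congr rfl fun m _ => expand m, ← Finset.sum_mul, Finset.sum_comm]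
  congr 1
  rw [Finset.sum_eq_single_of_mem 0 (Finset.mem_range.mpr hn)]
  · simp
  · intro k hk hk0
    have hne : ζ ^ k - 1 ≠ 0 :=
      sub_ne_zero.mpr (hζ.pow_ne_one_of_pos_of_lt hk0 (Finset.mem_range.mp hk))
    have hgeom := mul_geom_sum (ζ ^ k) n
    rw [← pow_mul, mul_comm k, pow_mul, hζ.pow_eq_one, one_pow, sub_self] at hgeom
    rw [← Finset.mul_sum, (mul_eq_zero.mp hgeom).resolve_left hne, mul_zero]

lemma normSq_one_sub_exp_pos {a b : ℝ} (hb : Real.sin b ≠ 0) :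
    0 < 1 - 2 * Real.exp (-2 * a) * Real.cos (2 * b) + Real.exp (-2 * a) ^ 2 := by
  have h1 := Real.sin_sq_add_cos_sq b
  have h2 : 0 < Real.sin b ^ 2 := by positivity
  have h3 := Real.exp_pos (-2 * a)
  rw [Real.cos_two_mul]
  nlinarith [sq_nonneg (1 - Real.exp (-2 * a)), mul_pos h2 h3]

lemma im_inv_one_sub_exp (a b : ℝ) :
    ((1 - Complex.exp (2 * (b * Complex.I - a)))⁻¹).im =
      Real.exp (-2 * a) * Real.sin (2 * b) /
        (1 - 2 * Real.exp (-2 * a) * Real.cos (2 * b) + Real.exp (-2 * a) ^ 2) := by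
  have hre : (2 * (b * Complex.I - a)).re = -2 * a := by simp
  have him : (2 * (b * Complex.I - a)).im = 2 * b := by simp
  rw [Complex.inv_im, Complex.normSq_apply]
  simp only [Complex.sub_re, Complex.sub_im, Complex.exp_re, Complex.exp_im, hre, him,
    Complex.one_re, Complex.one_im]
  congr 1
  · ring
  · linear_combination (Real.exp (-2 * a)) ^ 2 * Real.sin_sq_add_cos_sq (2 * b)

lemma hasDerivAt_arctan_tanh_div_tan {b : ℝ} (hb : Real.sin b ≠ 0) (a : ℝ) :
    HasDerivAt (fun t => Real.arctan (Real.tanh t / Real.tan b))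
      (2 * ((1 - Complex.exp (2 * (b * Complex.I - a)))⁻¹).im) a := by
  have hcosh : Real.cosh a ≠ 0 := (Real.cosh_pos a).ne'
  have htanh : HasDerivAt Real.tanh
      ((Real.cosh a * Real.cosh a - Real.sinh a * Real.sinh a) / Real.cosh a ^ 2) a := by
    have := (Real.hasDerivAt_sinh a).div (Real.hasDerivAt_cosh a) hcosh
    exact this.congr_of_eventuallyEq (.of_forall Real.tanh_eq_sinh_div_cosh)
  refine (htanh.div_const (Real.tan b)).arctan.congr_deriv ?_
  rw [im_inv_one_sub_exp]
  have hsq := Real.cosh_sq a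
  have hE : Real.exp (-2 * a) = (Real.cosh a - Real.sinh a) ^ 2 := by
    rw [Real.cosh_sub_sinh, ← Real.exp_nat_mul]; congr 1; push_cast; ring
  have hsum : Real.sin b ^ 2 * Real.cosh a ^ 2 + Real.cos b ^ 2 * Real.sinh a ^ 2 ≠ 0 := by
    positivity
  have hden : 1 - 2 * Real.exp (-2 * a) * Real.cos (2 * b) + Real.exp (-2 * a) ^ 2 =
      4 * Real.exp (-2 * a) *
        (Real.sin b ^ 2 * Real.cosh a ^ 2 + Real.cos b ^ 2 * Real.sinh a ^ 2) := by
    have hEF : Real.exp (-2 * a) * (Real.cosh a + Real.sinh a) ^ 2 = 1 := by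
      rw [hE]
      linear_combination (Real.cosh a ^ 2 - Real.sinh a ^ 2 + 1) * hsq
    have hc := Real.sin_sq b
    rw [Real.cos_two_mul, hc, hE]
    rw [hE] at hEF
    have hs : Real.sinh a ^ 2 = Real.cosh a ^ 2 - 1 := by linarith
    grind
  have hquot : Real.tanh a / Real.tan b =
      Real.sinh a * Real.cos b / (Real.cosh a * Real.sin b) := by
    rw [Real.tanh_eq_sinh_div_cosh, Real.tan_eq_sin_div_cos, div_div_div_eq]
  have hone : 1 + (Real.tanh a / Real.tan b) ^ 2 =
      (Real.sin b ^ 2 * Real.cosh a ^ 2 + Real.cos b ^ 2 * Real.sinh a ^ 2) /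
        (Real.cosh a * Real.sin b) ^ 2 := by
    rw [hquot]; field_simp
  have hnum : Real.cosh a * Real.cosh a - Real.sinh a * Real.sinh a = 1 := by linarith
  have hexp := (Real.exp_pos (-2 * a)).ne'
  rw [hden, hone, hnum, Real.tan_eq_sin_div_cos, Real.sin_two_mul]
  field_simp
  ring

/-- Multiplication formula: the finite form of the Euler–Ramanujan arctangent identity. -/
lemma arctan_tanh_nat_mul_div_tan_nat_mul {n : ℕ} (hn : n ≠ 0) {b : ℝ}
    (hb : ∀ m < n, Real.sin (b + m * π / n) ≠ 0) (hnb : Real.sin (n * b) ≠ 0) (a : ℝ) :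
    Real.arctan (Real.tanh (n * a) / Real.tan (n * b)) =
      ∑ m ∈ Finset.range n, Real.arctan (Real.tanh a / Real.tan (b + m * π / n)) := by
  have hn' : (n : ℂ) ≠ 0 := Nat.cast_ne_zero.mpr hn
  have hderiv (t : ℝ) : HasDerivAt (fun t : ℝ =>
      Real.arctan (Real.tanh (n * t) / Real.tan (n * b)) -
        ∑ m ∈ Finset.range n, Real.arctan (Real.tanh t / Real.tan (b + m * π / n))) 0 t := by
    have hleft : HasDerivAt (fun t : ℝ => Real.arctan (Real.tanh (n * t) / Real.tan (n * b))) _ t :=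
      (hasDerivAt_arctan_tanh_div_tan hnb (n * t)).comp t ((hasDerivAt_id t).const_mul (n : ℝ))
    have hright := HasDerivAt.fun_sum (u := Finset.range n) (x := t) fun m hm =>
      hasDerivAt_arctan_tanh_div_tan (hb m (Finset.mem_range.mp hm)) t
    refine (hleft.sub hright).congr_deriv ?_
    set w : ℂ := Complex.exp (2 * (b * Complex.I - t)) with hw
    have hwn : Complex.exp (2 * (((n * b : ℝ) : ℂ) * Complex.I - ((n * t : ℝ) : ℂ))) = w ^ n := by
      rw [hw, ← Complex.exp_nat_mul]; congr 1; push_cast; ring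
    have hwne : w ^ n ≠ 1 := by
      intro h
      have hpos := normSq_one_sub_exp_pos (a := n * t) hnb
      have h1 := congrArg Complex.re (hwn.trans h)
      have h2 := congrArg Complex.im (hwn.trans h)
      have hre : (2 * (((n * b : ℝ) : ℂ) * Complex.I - ((n * t : ℝ) : ℂ))).re =
        -2 * (n * t) := by simp
      have him : (2 * (((n * b : ℝ) : ℂ) * Complex.I - ((n * t : ℝ) : ℂ))).im =
        2 * (n * b) := by simp
      rw [Complex.exp_re, hre, him, Complex.one_re] at h1
      rw [Complex.exp_im, hre, him, Complex.one_im] at h2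
      have h3 := Real.sin_sq_add_cos_sq (2 * (n * b))
      have h4 : Real.exp (-2 * (n * t)) ^ 2 = 1 := by
        linear_combination (-Real.exp (-2 * (n * t)) ^ 2) * h3 +
          (Real.exp (-2 * (n * t)) * Real.cos (2 * (n * b)) + 1) * h1 +
          Real.exp (-2 * (n * t)) * Real.sin (2 * (n * b)) * h2
      linarith
    have hterm (m : ℕ) : Complex.exp (2 * (((b + m * π / n : ℝ) : ℂ) * Complex.I - t)) =
        w * Complex.exp (2 * π * Complex.I / n) ^ m := by
      rw [hw, ← Complex.exp_nat_mul, ← Complex.exp_add]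
      congr 1; push_cast; field_simp; ring
    have hsum := congrArg Complex.im
      ((Complex.isPrimitiveRoot_exp n hn).sum_inv_one_sub_mul_pow hwne)
    rw [Complex.im_sum, ← nsmul_eq_mul, Complex.smul_im, nsmul_eq_mul] at hsum
    simp only [hterm]
    rw [hwn, ← Finset.mul_sum, hsum]
    ring
  have hconst := is_const_of_deriv_eq_zero (fun t => (hderiv t).differentiableAt)
    (fun t => (hderiv t).deriv) a 0
  simpa [sub_eq_zero] using hconst

lemma kamienH_mul_sec (x y : ℝ) {β : ℝ} (hβ : Real.cos β ≠ 0) :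
    kamienH (x * (1 / Real.cos β)) y (2 * β) =
      -(1 / Real.cos β) * Real.arctan (Real.tanh (x * Real.sin β) / Real.tan (y * Real.sin β)) := by
  have hx : x * (1 / Real.cos β) / 2 * Real.sin (2 * β) = x * Real.sin β := by
    rw [Real.sin_two_mul]; field_simp
  rw [kamienH, hx, mul_div_cancel_left₀ β two_ne_zero]

/-- A zero of `sin (n b)` is a zero of one of the shifts `sin (b + m π / n)`. -/
lemma sin_nat_mul_ne_zero {n : ℕ} (hn : n ≠ 0) {b : ℝ}
    (hb : ∀ m < n, Real.sin (b + m * π / n) ≠ 0) : Real.sin (n * b) ≠ 0 := by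
  intro h
  obtain ⟨k, hk⟩ := Real.sin_eq_zero_iff.mp h
  have hnZ : (n : ℤ) ≠ 0 := by exact_mod_cast hn
  have hnR : (n : ℝ) ≠ 0 := by exact_mod_cast hn
  obtain ⟨m, hm⟩ := Int.eq_ofNat_of_zero_le (Int.emod_nonneg (-k) hnZ)
  have hmn : m < n := by
    have := Int.emod_lt_of_pos (-k) (b := n) (by omega)
    omega
  refine hb m hmn (Real.sin_eq_zero_iff.mpr ⟨-((-k) / n), ?_⟩)
  have hdiv : (m : ℝ) + n * (((-k) / n : ℤ) : ℝ) = -k := by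
    have := Int.emod_add_mul_ediv (-k) n
    rw [hm] at this
    exact_mod_cast this
  push_cast
  field_simp
  linear_combination hk - π * hdiv

/-- Kamien's finite self-decomposition of the Scherk first surface:
if `sin β = n·sin β̃` then
`h(x·sec β, y; 2β) = (cos β̃ / cos β) · ∑_{m=0}^{n-1} h(x·sec β̃, y + (m/n)π·csc β̃; 2β̃)`. -/
theorem kamien_scherk_first_surface_decomposition
    (n : ℕ) (hn : 1 ≤ n) (β β' : ℝ)
    (hβ : Real.cos β ≠ 0) (hβ' : Real.cos β' ≠ 0) (hsβ' : Real.sin β' ≠ 0)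
    (hsin : Real.sin β = n * Real.sin β')
    (x y : ℝ)
    (hy : ∀ m < n, ∀ k : ℤ, y * Real.sin β' + (m : ℝ) * π / n ≠ (k : ℝ) * π) :
    kamienH (x * (1 / Real.cos β)) y (2 * β) =
      (Real.cos β' / Real.cos β) *
        ∑ m ∈ Finset.range n,
          kamienH (x * (1 / Real.cos β'))
            (y + ((m : ℝ) / n) * π * (1 / Real.sin β')) (2 * β') := by
  have hn0 : n ≠ 0 := Nat.one_le_iff_ne_zero.mp hn
  have hnR : (n : ℝ) ≠ 0 := Nat.cast_ne_zero.mpr hn0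
  have hb : ∀ m < n, Real.sin (y * Real.sin β' + m * π / n) ≠ 0 := fun m hm h => by
    obtain ⟨k, hk⟩ := Real.sin_eq_zero_iff.mp h
    exact hy m hm k hk.symm
  have hshift (m : ℕ) : (y + (m : ℝ) / n * π * (1 / Real.sin β')) * Real.sin β' =
      y * Real.sin β' + m * π / n := by
    field_simp
  have hmul (z : ℝ) : z * Real.sin β = n * (z * Real.sin β') := by rw [hsin]; ring
  simp only [kamienH_mul_sec _ _ hβ, kamienH_mul_sec _ _ hβ', hshift]
  rw [hmul x, hmul y, arctan_tanh_nat_mul_div_tan_nat_mul hn0 hb (sin_nat_mul_ne_zero hn0 hb),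
    ← Finset.mul_sum, ← mul_assoc]
  congr 1
  field_simp
end
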